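/- arXiv:2104.06576 — 3 statements merged into one kernel-verified Lean document; each statement's English description precedes it below -/
import Mathlib

section
/- Let $p \ge 1$, let $\mathcal{L} \subset \mathbb{R}^m$ be a lattice with basis matrix $\mathbf{B}$, and let $\vec{x}_1, \vec{x}_2 \in \mathcal{L}$ be primitive lattice vectors with $\vec{x}_1 \ne \pm\vec{x}_2$ and $\|\vec{x}_1\|_p \ge \|\vec{x}_2\|_p$, such that $\mathbf{B}^{-1}\vec{x}_1 \equiv \alpha \, \mathbf{B}^{-1}\vec{x}_2 \pmod{Q}$ for some prime $Q \ge 100$ and some $\alpha \in \mathbb{Z}_Q$. Then the number of primitive lattice vectors of $\ell_p$ norm at most $\|\vec{x}_1\|_p$ is strictly greater than $Q/(20 \log Q)$. -/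
noncomputable def pnorm (p : ℝ) {m : ℕ} (x : Fin m → ℝ) : ℝ :=
  (∑ i, |x i| ^ p) ^ (1 / p)

theorem aux_chebyshev (Q : ℕ) (hQ100 : 100 ≤ Q) :
    (Q : ℝ) / (20 * Real.log Q) < (Nat.primesLE (Q / 2)).card := by
  rw [Nat.primesLE_card_eq_primeCounting]
  set n := Q / 2 with hn
  have hn50 : 50 ≤ n := by omega
  have hQn : Q ≤ 2 * n + 1 := by omega
  have hnQ : n ≤ Q := by omega
  have hn50' : (50 : ℝ) ≤ n := by exact_mod_cast hn50
  have hQn' : (Q : ℝ) ≤ 2 * n + 1 := by exact_mod_cast hQn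
  have hnQ' : (n : ℝ) ≤ Q := by exact_mod_cast hnQ
  have h1 := Chebyshev.psi_ge n
  have h2 := Chebyshev.psi_le_primeCounting_mul_log n
  have h3 : Real.log n ≤ Real.log Q := Real.log_le_log (by linarith) hnQ'
  have hlogpos : 0 < Real.log Q := Real.log_pos (by linarith)
  have h4 : Real.log (n + 1) ≤ (n + 1) / 8 - 1 + 3 * Real.log 2 := by
    have e : Real.log (n + 1) = Real.log ((n + 1) / 8) + 3 * Real.log 2 := by
      rw [Real.log_div (by linarith) (by norm_num)]
      have : Real.log 8 = 3 * Real.log 2 := by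
        rw [show (8 : ℝ) = 2 ^ 3 by norm_num, Real.log_pow]; norm_num
      linarith
    have := Real.log_le_sub_one_of_pos (x := ((n : ℝ) + 1) / 8) (by linarith)
    linarith
  have h5 := Real.log_two_gt_d9
  have h6 : (Nat.primeCounting n : ℝ) * Real.log n ≤ Nat.primeCounting n * Real.log Q :=
    mul_le_mul_of_nonneg_left h3 (by positivity)
  rw [div_lt_iff₀ (by positivity)]
  nlinarith

theorem aux_pair (s Q : ℕ) (q : ℤ) (hs : s.Prime) (hsQ : s ≤ Q / 2) (hq : q ≠ 0)
    (hqQ : 2 * |q| ≤ Q) : ∃ t : ℤ, IsCoprime (s : ℤ) t ∧ (s : ℤ) + |t * Q - s * q| ≤ Q := by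
  have hs2 := hs.two_le
  have hsQ' : 2 * (s : ℤ) ≤ Q := by omega
  have hQpos : (0 : ℤ) < Q := by omega
  -- nearest integer
  obtain ⟨t, ht⟩ : ∃ t : ℤ, 2 * |t * Q - s * q| ≤ Q := by
    refine ⟨(2 * (s * q) + Q) / (2 * Q), ?_⟩
    have e := Int.mul_ediv_add_emod (2 * (s * q) + Q) (2 * Q)
    have e1 := Int.emod_nonneg (2 * (s * q) + Q) (b := 2 * Q) (by omega)
    have e2 := Int.emod_lt_of_pos (2 * (s * q) + Q) (b := 2 * Q) (by omega)
    have h3 : |2 * ((2 * (s * q) + Q) / (2 * Q) * Q - s * q)| ≤ (Q : ℤ) := by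
      rw [abs_le]
      constructor <;> linarith
    rwa [abs_mul, abs_two] at h3
  by_cases hdvd : (s : ℤ) ∣ t
  · have ht0 : t = 0 := by
      apply Int.eq_zero_of_abs_lt_dvd hdvd
      have h1 : |t * Q| ≤ |t * Q - s * q| + |(s : ℤ) * q| := by
        simpa using abs_add_le (t * Q - s * q) (s * q)
      rw [abs_mul, abs_mul, abs_of_pos hQpos, abs_of_nonneg (by positivity : (0 : ℤ) ≤ s)] at h1
      by_contra hcon
      push Not at hcon
      have : (s : ℤ) * Q ≤ |t| * Q := mul_le_mul_of_nonneg_right hcon hQpos.le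
      have : (s : ℤ) * (2 * |q|) ≤ s * Q := mul_le_mul_of_nonneg_left hqQ (by positivity)
      have : (2 : ℤ) * Q ≤ s * Q := mul_le_mul_of_nonneg_right (by exact_mod_cast hs2) hQpos.le
      linarith
    subst ht0
    have h2 : 2 * ((s : ℤ) * |q|) ≤ Q := by
      simpa [abs_mul] using ht
    rcases lt_or_gt_of_ne hq with h | h
    · refine ⟨-1, isCoprime_one_right.neg_right, ?_⟩
      rw [abs_of_neg h] at h2
      rw [abs_of_nonpos (by nlinarith)]
      nlinarith
    · refine ⟨1, isCoprime_one_right, ?_⟩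
      rw [abs_of_pos h] at h2
      rw [abs_of_nonneg (by nlinarith)]
      nlinarith
  · refine ⟨t, ?_, by omega⟩
    exact (Nat.prime_iff_prime_int.mp hs).coprime_iff_not_dvd.mpr hdvd

theorem aux_pnorm_nonneg (p : ℝ) {m : ℕ} (x : Fin m → ℝ) : 0 ≤ pnorm p x := by
  unfold pnorm; positivity

theorem aux_pnorm_add (p : ℝ) (hp : 1 ≤ p) {m : ℕ} (x y : Fin m → ℝ) :
    pnorm p (x + y) ≤ pnorm p x + pnorm p y :=
  Real.Lp_add_le Finset.univ x y hp

theorem aux_pnorm_smul (p : ℝ) (hp : 1 ≤ p) {m : ℕ} (z : ℤ) (x : Fin m → ℝ) :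
    pnorm p (z • x) = |(z : ℝ)| * pnorm p x := by
  unfold pnorm
  have : ∀ i, |(z • x) i| ^ p = |(z : ℝ)| ^ p * |x i| ^ p := by
    intro i
    rw [Pi.smul_apply, zsmul_eq_mul, abs_mul, Real.mul_rpow (abs_nonneg _) (abs_nonneg _)]
  simp_rw [this]
  rw [← Finset.mul_sum, Real.mul_rpow (by positivity) (by positivity), ← Real.rpow_mul (abs_nonneg _),
    mul_one_div_cancel (by linarith), Real.rpow_one]

theorem aux_coord_le (p : ℝ) (hp : 1 ≤ p) {m : ℕ} (x : Fin m → ℝ) (i : Fin m) :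
    |x i| ≤ pnorm p x := by
  unfold pnorm
  have h : |x i| ^ p ≤ ∑ i, |x i| ^ p :=
    Finset.single_le_sum (f := fun i => |x i| ^ p) (fun j _ => by positivity) (Finset.mem_univ i)
  have h2 := Real.rpow_le_rpow (by positivity) h (by positivity : (0 : ℝ) ≤ 1 / p)
  rwa [← Real.rpow_mul (abs_nonneg _), mul_one_div_cancel (by linarith), Real.rpow_one] at h2

noncomputable def auxVec {m k : ℕ} (b : Fin k → (Fin m → ℝ)) (c : Fin k → ℤ) : Fin m → ℝ :=
  ∑ i, c i • b i

theorem auxVec_add {m k : ℕ} (b : Fin k → (Fin m → ℝ)) (c d : Fin k → ℤ) :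
    auxVec b (c + d) = auxVec b c + auxVec b d := by
  simp [auxVec, add_smul, Finset.sum_add_distrib]

theorem auxVec_smul {m k : ℕ} (b : Fin k → (Fin m → ℝ)) (z : ℤ) (c : Fin k → ℤ) :
    auxVec b (z • c) = z • auxVec b c := by
  simp only [auxVec, Finset.smul_sum, Pi.smul_apply, smul_eq_mul, mul_smul]

theorem auxVec_eq {m k : ℕ} (b : Fin k → (Fin m → ℝ)) (c : Fin k → ℤ) :
    auxVec b c = Fintype.linearCombination ℝ b (fun i => (c i : ℝ)) := by
  simp only [auxVec, Fintype.linearCombination_apply, Int.cast_smul_eq_zsmul]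

theorem auxVec_inj {m k : ℕ} (b : Fin k → (Fin m → ℝ)) (hb : LinearIndependent ℝ b) :
    Function.Injective (auxVec b) := by
  intro c d h
  rw [auxVec_eq, auxVec_eq] at h
  have := hb.fintypeLinearCombination_injective h
  ext i
  have := congrFun this i
  exact_mod_cast this

theorem auxVec_finite {m k : ℕ} (p : ℝ) (hp : 1 ≤ p) (b : Fin k → (Fin m → ℝ))
    (hb : LinearIndependent ℝ b) (r : ℝ) :
    {c : Fin k → ℤ | pnorm p (auxVec b c) ≤ r}.Finite := by
  obtain ⟨K, hK, hanti⟩ := (Fintype.linearCombination ℝ b).exists_antilipschitzWith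
    (LinearMap.ker_eq_bot.mpr hb.fintypeLinearCombination_injective)
  apply (Set.finite_Icc (fun _ : Fin k => -⌈K * r⌉) (fun _ => ⌈K * r⌉)).subset
  intro c hc
  have hc' : pnorm p (auxVec b c) ≤ r := hc
  have hr : 0 ≤ r := (aux_pnorm_nonneg _ _).trans hc'
  have h1 : ‖auxVec b c‖ ≤ r := by
    rw [pi_norm_le_iff_of_nonneg hr]
    intro i
    exact (aux_coord_le p hp _ i).trans hc'
  have h2 := hanti.le_mul_dist (fun i => (c i : ℝ)) 0
  rw [map_zero, dist_zero_right, dist_zero_right] at h2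
  rw [auxVec_eq] at h1
  have h3 : ∀ i, |(c i : ℝ)| ≤ ⌈K * r⌉ := fun i =>
    (norm_le_pi_norm (fun i => (c i : ℝ)) i).trans
      ((h2.trans (mul_le_mul_of_nonneg_left h1 K.2)).trans (Int.le_ceil _))
  rw [Set.mem_Icc]
  constructor
  · intro i
    have := (abs_le.mp (h3 i)).1
    exact_mod_cast this
  · intro i
    have := (abs_le.mp (h3 i)).2
    exact_mod_cast this

theorem aux_prim_iff {m k : ℕ} (b : Fin k → (Fin m → ℝ)) (hb : LinearIndependent ℝ b)
    (L : Set (Fin m → ℝ)) (hL : L = {v | ∃ z : Fin k → ℤ, v = ∑ i, z i • b i})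
    (Lprim : Set (Fin m → ℝ))
    (hLprim : Lprim = {v | v ∈ L ∧ ∀ (z : ℤ) (x : Fin m → ℝ), x ∈ L → 1 < z → v ≠ z • x})
    (c : Fin k → ℤ) : auxVec b c ∈ Lprim ↔ Finset.univ.gcd c = 1 := by
  subst hLprim hL
  constructor
  · rintro ⟨-, h⟩
    have h0 : 0 ≤ Finset.univ.gcd c := Finset.Int.finsetGcd_nonneg
    have key : ∀ z : ℤ, 1 < z → ¬ ∀ i, z ∣ c i := by
      intro z hz hd
      choose d hd using hd
      refine h z (auxVec b d) ⟨d, rfl⟩ hz ?_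
      rw [← auxVec_smul]
      congr 1
      ext i
      simp [hd i]
    by_contra hne
    rcases (by omega : Finset.univ.gcd c = 0 ∨ 1 < Finset.univ.gcd c) with hz | hz
    · rw [Finset.gcd_eq_zero_iff] at hz
      exact key 2 (by norm_num) fun i => by simp [hz i]
    · exact key _ hz fun i => Finset.gcd_dvd (Finset.mem_univ i)
  · intro h
    refine ⟨⟨c, rfl⟩, ?_⟩
    rintro z x ⟨d, rfl⟩ hz heq
    change auxVec b c = z • auxVec b d at heq
    rw [← auxVec_smul] at heq
    have hcd := auxVec_inj b hb heq
    have : z ∣ Finset.univ.gcd c := Finset.dvd_gcd fun i _ => ⟨d i, by rw [hcd]; simp⟩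
    rw [h] at this
    have := Int.le_of_dvd one_pos this
    omega

theorem aux_indep {k : ℕ} (a₁ a₂ : Fin k → ℤ) (h1 : Finset.univ.gcd a₁ = 1)
    (h2 : Finset.univ.gcd a₂ = 1) (hne : a₁ ≠ a₂) (hne' : a₁ ≠ -a₂) (A C : ℤ)
    (h : ∀ i, A * a₁ i = C * a₂ i) : A = 0 ∧ C = 0 := by
  have e1 := Finset.gcd_mul_left (s := Finset.univ) (f := a₁) (a := A)
  have e2 := Finset.gcd_mul_left (s := Finset.univ) (f := a₂) (a := C)
  rw [h1, mul_one] at e1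
  rw [h2, mul_one] at e2
  simp_rw [h] at e1
  rw [e1] at e2
  rw [← Int.abs_eq_normalize, ← Int.abs_eq_normalize] at e2
  by_cases hA : A = 0
  · subst hA
    rw [abs_zero] at e2
    exact ⟨rfl, abs_eq_zero.mp e2.symm⟩
  · exfalso
    rcases abs_eq_abs.mp e2 with e | e
    · apply hne
      ext i
      apply mul_left_cancel₀ hA
      rw [h i, e]
    · apply hne'
      ext i
      apply mul_left_cancel₀ hA
      rw [h i, e]
      simp

theorem stmt_13 (m k Q : ℕ) (p : ℝ) (hp : 1 ≤ p) (hQ : Q.Prime) (hQ100 : 100 ≤ Q)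
    (b : Fin k → (Fin m → ℝ)) (hb : LinearIndependent ℝ b)
    (L : Set (Fin m → ℝ)) (hL : L = {v | ∃ z : Fin k → ℤ, v = ∑ i, z i • b i})
    (Lprim : Set (Fin m → ℝ))
    (hLprim : Lprim = {v | v ∈ L ∧ ∀ (z : ℤ) (x : Fin m → ℝ), x ∈ L → 1 < z → v ≠ z • x})
    (x₁ x₂ : Fin m → ℝ) (hx₁ : x₁ ∈ Lprim) (hx₂ : x₂ ∈ Lprim)
    (hne : x₁ ≠ x₂) (hne' : x₁ ≠ -x₂)
    (hnorm : pnorm p x₂ ≤ pnorm p x₁)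
    (a₁ a₂ : Fin k → ℤ) (hx₁c : x₁ = ∑ i, a₁ i • b i) (hx₂c : x₂ = ∑ i, a₂ i • b i)
    (α : ZMod Q) (hcong : ∀ i, ((a₁ i : ZMod Q)) = α * ((a₂ i : ZMod Q))) :
    (Q : ℝ) / (20 * Real.log Q) < (({v | v ∈ Lprim ∧ pnorm p v ≤ pnorm p x₁}).ncard : ℝ) := by
  have hprim := aux_prim_iff b hb L hL Lprim hLprim
  change x₁ = auxVec b a₁ at hx₁c
  change x₂ = auxVec b a₂ at hx₂c
  subst hx₁c hx₂c
  rw [hprim] at hx₁ hx₂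
  have hane : a₁ ≠ a₂ := fun h => hne (by rw [h])
  have hane' : a₁ ≠ -a₂ := fun h => hne' (by
    rw [h, show -a₂ = (-1 : ℤ) • a₂ by simp, auxVec_smul]; simp)
  have hind := aux_indep a₁ a₂ hx₁ hx₂ hane hane'
  have : Fact Q.Prime := ⟨hQ⟩
  have : NeZero Q := ⟨hQ.ne_zero⟩
  set q : ℤ := α.valMinAbs with hqdef
  have hqα : (q : ZMod Q) = α := ZMod.coe_valMinAbs α
  have hdvd : ∀ i, (Q : ℤ) ∣ a₁ i - q * a₂ i := by
    intro i
    rw [← ZMod.intCast_zmod_eq_zero_iff_dvd]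
    push_cast
    rw [hqα, hcong i, sub_self]
  choose y hy using hdvd
  have hQpos : (0 : ℤ) < Q := by exact_mod_cast hQ.pos
  have hq0 : q ≠ 0 := by
    intro h0
    have : (Q : ℤ) ∣ Finset.univ.gcd a₁ := Finset.dvd_gcd fun i _ => ⟨y i, by
      have := hy i; rw [h0] at this; linarith⟩
    rw [hx₁] at this
    have := Int.le_of_dvd one_pos this
    omega
  have hqQ : 2 * |q| ≤ Q := by
    have := ZMod.natAbs_valMinAbs_le α
    rw [← hqdef] at this
    rw [Int.abs_eq_natAbs]
    omega
  set r := pnorm p (auxVec b a₁) with hr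
  have main : ∀ s ∈ Nat.primesLE (Q / 2), ∃ w : Fin k → ℤ, ∃ g t : ℤ, 0 < g ∧
      IsCoprime (s : ℤ) t ∧ Finset.univ.gcd w = 1 ∧ pnorm p (auxVec b w) ≤ r ∧
      ∀ i, g * w i = s * y i + t * a₂ i := by
    intro s hs
    obtain ⟨hsQ, hsp⟩ := Nat.mem_primesLE.mp hs
    obtain ⟨t, hcop, ht⟩ := aux_pair s Q q hsp hsQ hq0 hqQ
    set c : Fin k → ℤ := fun i => s * y i + t * a₂ i with hc
    have hQc : (Q : ℤ) • c = (s : ℤ) • a₁ + (t * Q - s * q) • a₂ := by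
      ext i
      simp only [hc, Pi.smul_apply, Pi.add_apply, smul_eq_mul]
      have := hy i
      linear_combination (-(s : ℤ)) * this
    have hcne : Finset.univ.gcd c ≠ 0 := by
      intro h0
      rw [Finset.gcd_eq_zero_iff] at h0
      have := hind s (-(t * Q - s * q)) (fun i => by
        have h := congrFun hQc i
        simp only [Pi.smul_apply, Pi.add_apply, smul_eq_mul, h0 i (Finset.mem_univ i)] at h
        linarith)
      exact hsp.ne_zero (by exact_mod_cast this.1)
    obtain ⟨x, hx⟩ := Finset.gcd_ne_zero_iff.mp hcne
    obtain ⟨w, hw, hw1⟩ := Finset.extract_gcd c ⟨x, hx.1⟩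
    have hgpos : 0 < Finset.univ.gcd c :=
      lt_of_le_of_ne Finset.Int.finsetGcd_nonneg hcne.symm
    refine ⟨w, Finset.univ.gcd c, t, hgpos, hcop, hw1, ?_, fun i => (hw i (Finset.mem_univ i)).symm⟩
    have hr0 : 0 ≤ r := aux_pnorm_nonneg _ _
    have hcw : c = Finset.univ.gcd c • w := by
      ext i; exact hw i (Finset.mem_univ i)
    have n1 : (Q : ℝ) * pnorm p (auxVec b c) ≤ Q * r := by
      have e : pnorm p (auxVec b ((Q : ℤ) • c)) = Q * pnorm p (auxVec b c) := by
        rw [auxVec_smul, aux_pnorm_smul p hp]; simp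
      rw [← e, hQc, auxVec_add, auxVec_smul, auxVec_smul]
      refine (aux_pnorm_add p hp _ _).trans ?_
      rw [aux_pnorm_smul p hp, aux_pnorm_smul p hp]
      have ht' : (s : ℝ) + |((t * Q - s * q : ℤ) : ℝ)| ≤ Q := by exact_mod_cast ht
      have := mul_le_mul_of_nonneg_left hnorm (abs_nonneg ((t * Q - s * q : ℤ) : ℝ))
      have h3 := mul_le_mul_of_nonneg_right ht' hr0
      have h4 : |(((s : ℤ) : ℝ))| = s := by simp
      rw [h4]
      linarith
    have n2 : pnorm p (auxVec b c) ≤ r :=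
      le_of_mul_le_mul_left n1 (by exact_mod_cast hQ.pos)
    rw [hcw, auxVec_smul, aux_pnorm_smul p hp] at n2
    have hg1 : (1 : ℝ) ≤ |((Finset.univ.gcd c : ℤ) : ℝ)| := by
      rw [abs_of_pos (by exact_mod_cast hgpos)]
      exact_mod_cast hgpos
    have := mul_le_mul_of_nonneg_right hg1 (aux_pnorm_nonneg p (auxVec b w))
    linarith
  choose! w g t hg hcop hw1 hwr hw using main
  refine (aux_chebyshev Q hQ100).trans_le ?_
  have hfin : {v | v ∈ Lprim ∧ pnorm p v ≤ r}.Finite := by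
    apply ((auxVec_finite p hp b hb r).image (auxVec b)).subset
    rintro v ⟨hv, hvr⟩
    rw [hLprim, hL] at hv
    obtain ⟨⟨z, rfl⟩, -⟩ := hv
    exact ⟨z, hvr, rfl⟩
  rw [Nat.cast_le, ← Set.ncard_coe_finset]
  refine Set.ncard_le_ncard_of_injOn (fun s => auxVec b (w s)) ?_ ?_ hfin
  · intro s hs
    exact ⟨(hprim _).mpr (hw1 s hs), hwr s hs⟩
  · intro s hs s' hs' heq
    have hww : w s = w s' := auxVec_inj b hb heq
    have hs1 := hs
    have hs1' := hs'
    rw [Finset.mem_coe] at hs1 hs1'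
    have hrel := hind (g s' * s - g s * s')
      ((g s' * s - g s * s') * q - (g s' * t s - g s * t s') * Q) (fun i => by
        have e1 := hw s hs1 i
        have e2 := hw s' hs1' i
        rw [hww] at e1
        have := hy i
        linear_combination (g s' * s - g s * s') * this - Q * g s' * e1 + Q * g s * e2)
    obtain ⟨r1, r2⟩ := hrel
    rw [r1, zero_mul, zero_sub, neg_eq_zero] at r2
    have r3 := (mul_eq_zero.mp r2).resolve_right hQpos.ne'
    have hcross : (s : ℤ) * t s' = s' * t s := by
      apply mul_left_cancel₀ (hg s hs1).ne'
      linear_combination (t s) * r1 - (s : ℤ) * r3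
    have d1 : (s : ℤ) ∣ s' := (hcop s hs1).dvd_of_dvd_mul_right ⟨t s', hcross.symm⟩
    have d2 : (s' : ℤ) ∣ s := (hcop s' hs1').dvd_of_dvd_mul_right ⟨t s, hcross⟩
    exact Nat.dvd_antisymm (by exact_mod_cast d1) (by exact_mod_cast d2)
end

section
/- For any $1 \le p \le 2$, any lattice $\mathcal{L} \subset \mathbb{R}^m$, and any $a \ge 1$, the supergaussian mass outside the ball of $\ell_p$ radius $a(m/p)^{1/p}$ is exponentially small: $\sum_{\vec{x} \in \mathcal{L},\ \|\vec{x}\|_p \ge a(m/p)^{1/p}} e^{-\|\vec{x}\|_p^p} \le (e a^p e^{-a^p})^{m/p} \cdot \sum_{\vec{x} \in \mathcal{L}} e^{-\|\vec{x}\|_p^p}$. -/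
open Filter Topology in
theorem aux_binom (α : ℝ) (h0 : 0 ≤ α) (h1 : α ≤ 1) : ∃ d : ℕ → ℝ, (∀ n, 0 ≤ d n) ∧
    ∀ y : ℝ, 0 ≤ y → y < 1 → HasSum (fun n => d n * y ^ (n + 1)) (1 - (1 - y) ^ α) := by
  refine ⟨fun n => - ((-1) ^ (n + 1) * Ring.choose α (n + 1)), ?_, ?_⟩
  · intro n
    induction n with
    | zero => simpa using h0
    | succ n ih =>
      have h := Ring.choose_smul_choose α (n := n + 1 + 1) (k := n + 1) (by omega)
      have e : n + 1 + 1 - (n + 1) = 1 := by omega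
      rw [e, Ring.choose_one_right] at h
      simp at h
      have h3 : (0 : ℝ) < (n : ℝ) + 1 + 1 := by positivity
      have h4 : Ring.choose α (n + 1 + 1) = Ring.choose α (n + 1) * (α - (n + 1)) / (n + 1 + 1) := by
        field_simp
        linarith
      have h5 : - ((-1 : ℝ) ^ (n + 1 + 1) * Ring.choose α (n + 1 + 1))
        = - ((-1) ^ (n + 1) * Ring.choose α (n + 1)) * (((n : ℝ) + 1 - α) / (n + 1 + 1)) := by
        rw [h4]; ring
      simp only at ih ⊢
      rw [h5]
      apply mul_nonneg ih
      apply div_nonneg _ h3.le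
      have : (0 : ℝ) ≤ n := by positivity
      linarith
  · intro y hy0 hy1
    have h := (Real.one_add_rpow_hasFPowerSeriesOnBall_zero (a := α)).hasSum (y := -y) (by
      simp [abs_of_nonneg hy0, ← ENNReal.ofReal_one, Metric.eball_ofReal, hy1])
    simp at h
    rw [← hasSum_nat_add_iff' 1] at h
    have h2 := h.neg
    have hc : ∀ n, (binomialSeries ℝ α).coeff n = Ring.choose α n := fun n => by
      simp [binomialSeries]
    convert! h2 using 1
    · funext n
      rw [neg_pow y, hc]; ring
    · simp [hc]
      ring_nf

def gens (m : ℕ) : Set ((Fin m → ℝ) → ℝ) :=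
  {g | ∃ (r : ℝ) (t : Fin m → ℝ), 0 ≤ r ∧ (∀ i, 0 ≤ t i) ∧
    g = fun x => r * Real.exp (-∑ i, t i * x i ^ 2)}

def gensM (m : ℕ) : Submonoid ((Fin m → ℝ) → ℝ) where
  carrier := gens m
  one_mem' := ⟨1, 0, by simp, by simp, by funext x; simp⟩
  mul_mem' := by
    rintro _ _ ⟨r, t, hr, ht, rfl⟩ ⟨r', t', hr', ht', rfl⟩
    refine ⟨r * r', t + t', by positivity, fun i => add_nonneg (ht i) (ht' i), ?_⟩
    funext x
    simp only [Pi.mul_apply, Pi.add_apply, add_mul, Finset.sum_add_distrib, neg_add, Real.exp_add]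
    ring

def cone (m : ℕ) : Subsemiring ((Fin m → ℝ) → ℝ) :=
  (Subsemiring.closure (gensM m : Set ((Fin m → ℝ) → ℝ))).topologicalClosure

theorem cone_gen {m : ℕ} (r : ℝ) (t : Fin m → ℝ) (hr : 0 ≤ r) (ht : ∀ i, 0 ≤ t i) :
    (fun x : Fin m → ℝ => r * Real.exp (-∑ i, t i * x i ^ 2)) ∈ cone m :=
  Subsemiring.le_topologicalClosure _ (Subsemiring.subset_closure ⟨r, t, hr, ht, rfl⟩)

theorem cone_const {m : ℕ} (r : ℝ) (hr : 0 ≤ r) : (fun _ : Fin m → ℝ => r) ∈ cone m := by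
  simpa using cone_gen r (0 : Fin m → ℝ) hr (by simp)

open Filter Topology in
theorem cone_lim {m : ℕ} {ι : Type*} {l : Filter ι} [l.NeBot] {F : ι → (Fin m → ℝ) → ℝ}
    {g : (Fin m → ℝ) → ℝ} (hF : ∀ᶠ i in l, F i ∈ cone m)
    (h : ∀ x, Tendsto (fun i => F i x) l (𝓝 (g x))) : g ∈ cone m :=
  (Subsemiring.isClosed_topologicalClosure _).mem_of_tendsto (tendsto_pi_nhds.2 h) hF

open Filter Topology in
theorem cone_hasSum {m : ℕ} {F : ℕ → (Fin m → ℝ) → ℝ}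
    {g : (Fin m → ℝ) → ℝ} (hF : ∀ i, F i ∈ cone m)
    (h : ∀ x, HasSum (fun i => F i x) (g x)) : g ∈ cone m := by
  refine cone_lim (l := atTop) (F := fun s : Finset ℕ => ∑ i ∈ s, F i)
    (Eventually.of_forall fun s => sum_mem fun i _ => hF i) ?_
  intro x
  simpa [HasSum] using h x

theorem cone_exp {m : ℕ} {g : (Fin m → ℝ) → ℝ} (hg : g ∈ cone m) :
    (fun x => Real.exp (g x)) ∈ cone m := by
  refine cone_hasSum (F := fun n => (fun _ => ((n.factorial : ℝ))⁻¹) * g ^ n)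
    (fun n => mul_mem (cone_const _ (by positivity)) (pow_mem hg n)) ?_
  intro x
  have := NormedSpace.expSeries_div_hasSum_exp (𝔸 := ℝ) (g x)
  rw [← Real.exp_eq_exp_ℝ] at this
  simpa [div_eq_inv_mul] using this

theorem cone_step1 {m : ℕ} (i : Fin m) (α : ℝ) (h0 : 0 ≤ α) (h1 : α ≤ 1) (δ ε : ℝ) (hδ : 0 < δ)
    (hε : 0 < ε) : (fun x : Fin m → ℝ =>
      Real.exp (-((1 - Real.exp (-(x i ^ 2 + δ) * ε)) / ε) ^ α)) ∈ cone m := by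
  obtain ⟨d, hd, hs⟩ := aux_binom α h0 h1
  have hy : (fun x : Fin m → ℝ => Real.exp (-(x i ^ 2 + δ) * ε)) ∈ cone m := by
    convert cone_gen (m := m) (Real.exp (-δ * ε)) (Pi.single i ε) (by positivity) ?_ using 1
    · funext x
      rw [← Real.exp_add, Finset.sum_eq_single i]
      · simp; ring
      · intro j _ hj; simp [hj]
      · simp
    · intro j
      by_cases hj : j = i
      · subst hj; simp [hε.le]
      · simp [hj]
  have hG : (fun x : Fin m → ℝ => 1 - (1 - Real.exp (-(x i ^ 2 + δ) * ε)) ^ α) ∈ cone m := by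
    refine cone_hasSum (F := fun n => (fun _ => d n) *
      (fun x : Fin m → ℝ => Real.exp (-(x i ^ 2 + δ) * ε)) ^ (n + 1)) 
      (fun n => mul_mem (cone_const _ (hd n)) (pow_mem hy _)) ?_
    intro x
    refine hs _ (by positivity) ?_
    rw [Real.exp_lt_one_iff]
    have : 0 < (x i ^ 2 + δ) * ε := by positivity
    linarith
  have h2 := mul_mem (cone_const (m := m) (Real.exp (-(ε⁻¹ ^ α))) (by positivity))
    (cone_exp (mul_mem (cone_const (m := m) (ε⁻¹ ^ α) (by positivity)) hG))
  convert h2 using 1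
  funext x
  have : 0 < (x i ^ 2 + δ) * ε := by positivity
  simp only [Pi.mul_apply]
  rw [← Real.exp_add, div_eq_mul_inv, Real.mul_rpow _ (by positivity)]
  · congr 1; ring
  · rw [sub_nonneg, Real.exp_le_one_iff]; linarith

open Filter Topology in
theorem cone_step2 {m : ℕ} (i : Fin m) (α : ℝ) (h0 : 0 < α) (h1 : α ≤ 1) : (fun x : Fin m → ℝ =>
      Real.exp (-(x i ^ 2) ^ α)) ∈ cone m := by
  have key : ∀ δ : ℝ, 0 < δ → (fun x : Fin m → ℝ => Real.exp (-(x i ^ 2 + δ) ^ α)) ∈ cone m := by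
    intro δ hδ
    refine cone_lim (l := 𝓝[>] (0 : ℝ)) (F := fun ε x => 
      Real.exp (-((1 - Real.exp (-(x i ^ 2 + δ) * ε)) / ε) ^ α)) ?_ ?_
    · filter_upwards [self_mem_nhdsWithin] with ε hε
      exact cone_step1 i α h0.le h1 δ ε hδ hε
    · intro x
      have hd : HasDerivAt (fun ε : ℝ => 1 - Real.exp (-(x i ^ 2 + δ) * ε)) (x i ^ 2 + δ) 0 := by
        have := (((hasDerivAt_id (0 : ℝ)).const_mul (-(x i ^ 2 + δ))).exp).const_sub 1
        simpa using this
      have ht := hd.tendsto_slope_zero_right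
      simp only [zero_add, mul_zero, Real.exp_zero, sub_self, sub_zero, smul_eq_mul] at ht
      refine (Real.continuous_exp.tendsto _).comp (Tendsto.neg ?_)
      refine Tendsto.rpow_const ?_ (Or.inr h0.le)
      refine ht.congr fun ε => ?_
      rw [div_eq_inv_mul]
  refine cone_lim (l := 𝓝[>] (0 : ℝ)) (F := fun δ x => Real.exp (-(x i ^ 2 + δ) ^ α)) ?_ ?_
  · filter_upwards [self_mem_nhdsWithin] with ε hε
    exact key ε hε
  · intro x
    refine (Real.continuous_exp.tendsto _).comp (Tendsto.neg ?_)
    refine Tendsto.rpow_const ?_ (Or.inr h0.le)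
    have : Tendsto (fun δ : ℝ => x i ^ 2 + δ) (𝓝 0) (𝓝 (x i ^ 2 + 0)) :=
      (continuous_const.add continuous_id).tendsto 0
    rw [add_zero] at this
    exact this.mono_left nhdsWithin_le_nhds

theorem cone_main {m : ℕ} (p : ℝ) (hp1 : 1 ≤ p) (hp2 : p ≤ 2) :
    (fun x : Fin m → ℝ => Real.exp (-∑ i, |x i| ^ p)) ∈ cone m := by
  have h : (∏ i, (fun x : Fin m → ℝ => Real.exp (-(x i ^ 2) ^ (p / 2)))) ∈ cone m :=
    prod_mem fun i _ => cone_step2 i (p / 2) (by linarith) (by linarith)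
  convert h using 1
  funext x
  rw [Finset.prod_apply, ← Real.exp_sum, Finset.sum_neg_distrib]
  congr 2
  refine Finset.sum_congr rfl fun i _ => ?_
  rw [← sq_abs, ← Real.rpow_natCast, ← Real.rpow_mul (abs_nonneg _)]
  congr 1
  push_cast
  ring

open MeasureTheory in
theorem gauss_int {m : ℕ} (b : ℝ) (hb : 0 < b) (w : EuclideanSpace ℝ (Fin m)) :
    Integrable (fun v : EuclideanSpace ℝ (Fin m) => Real.exp (-b * ‖v‖ ^ 2) * Real.cos (inner ℝ w v))
    ∧ ∫ v : EuclideanSpace ℝ (Fin m), Real.exp (-b * ‖v‖ ^ 2) * Real.cos (inner ℝ w v)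
      = (Real.pi / b) ^ ((m : ℝ) / 2) * Real.exp (-‖w‖ ^ 2 / (4 * b)) := by
  have hb' : 0 < (b : ℂ).re := by simpa using hb
  have hi := GaussianFourier.integrable_cexp_neg_mul_sq_norm_add hb' Complex.I w
  have hv := GaussianFourier.integral_cexp_neg_mul_sq_norm_add hb' Complex.I w
  have hre : ∀ v : EuclideanSpace ℝ (Fin m), Real.exp (-b * ‖v‖ ^ 2) * Real.cos (inner ℝ w v)
      = RCLike.re (Complex.exp (-(b : ℂ) * ‖v‖ ^ 2 + Complex.I * (inner ℝ w v : ℝ))) := by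
    intro v
    have : (-(b : ℂ) * ‖v‖ ^ 2 + Complex.I * (inner ℝ w v : ℝ))
      = ((-b * ‖v‖ ^ 2 : ℝ) : ℂ) + (inner ℝ w v : ℝ) * Complex.I := by push_cast; ring
    rw [this, Complex.exp_add, ← Complex.ofReal_exp, RCLike.re_eq_complex_re,
      Complex.re_ofReal_mul, Complex.exp_ofReal_mul_I_re]
  simp_rw [hre]
  refine ⟨hi.re, ?_⟩
  rw [integral_re hi, hv]
  have : ((Real.pi : ℂ) / b) ^ ((Module.finrank ℝ (EuclideanSpace ℝ (Fin m)) : ℂ) / 2) *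
      Complex.exp (Complex.I ^ 2 * ‖w‖ ^ 2 / (4 * b))
      = (((Real.pi / b) ^ ((m : ℝ) / 2) * Real.exp (-‖w‖ ^ 2 / (4 * b)) : ℝ) : ℂ) := by
    rw [Complex.ofReal_mul, Complex.ofReal_cpow (by positivity)]
    simp
  rw [this]
  exact Complex.ofReal_re _

open MeasureTheory in
theorem gauss_pd {m : ℕ} {ι : Type*} (S : Finset ι) (w : ι → EuclideanSpace ℝ (Fin m)) (s : ℝ)
    (hs : 1 ≤ s) :
    ∑ i ∈ S, ∑ j ∈ S, Real.exp (-‖w i - w j‖ ^ 2 / s ^ 2)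
      ≤ s ^ m * ∑ i ∈ S, ∑ j ∈ S, Real.exp (-‖w i - w j‖ ^ 2) := by
  have hs0 : 0 < s := by linarith
  have key : ∀ b : ℝ, 0 < b →
      Integrable (fun v : EuclideanSpace ℝ (Fin m) => Real.exp (-b * ‖v‖ ^ 2) *
          ∑ i ∈ S, ∑ j ∈ S, Real.cos (inner ℝ (w i - w j) v)) ∧
      ∫ v : EuclideanSpace ℝ (Fin m), Real.exp (-b * ‖v‖ ^ 2) *
          ∑ i ∈ S, ∑ j ∈ S, Real.cos (inner ℝ (w i - w j) v) =
      (Real.pi / b) ^ ((m : ℝ) / 2) *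
        ∑ i ∈ S, ∑ j ∈ S, Real.exp (-‖w i - w j‖ ^ 2 / (4 * b)) := by
    intro b hb
    simp_rw [Finset.mul_sum]
    refine ⟨integrable_finsetSum _ fun i _ => integrable_finsetSum _ fun j _ =>
      (gauss_int b hb _).1, ?_⟩
    rw [integral_finsetSum _ fun i _ => integrable_finsetSum _ fun j _ =>
      (gauss_int b hb _).1]
    refine Finset.sum_congr rfl fun i _ => ?_
    rw [integral_finsetSum _ fun j _ => (gauss_int b hb _).1]
    exact Finset.sum_congr rfl fun j _ => (gauss_int b hb _).2
  have hpos : ∀ v : EuclideanSpace ℝ (Fin m),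
      0 ≤ ∑ i ∈ S, ∑ j ∈ S, Real.cos (inner ℝ (w i - w j) v) := by
    intro v
    have : ∑ i ∈ S, ∑ j ∈ S, Real.cos (inner ℝ (w i - w j) v)
      = (∑ i ∈ S, Real.cos (inner ℝ (w i) v)) ^ 2 + (∑ i ∈ S, Real.sin (inner ℝ (w i) v)) ^ 2 := by
      simp only [sq, Finset.sum_mul_sum, ← Finset.sum_add_distrib, inner_sub_left, Real.cos_sub]
    rw [this]; positivity
  have k1 := key (1 / 4) (by norm_num)
  have k2 := key (s ^ 2 / 4) (by positivity)
  have hle := integral_mono k2.1 k1.1 (fun v => by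
    refine mul_le_mul_of_nonneg_right (Real.exp_le_exp.2 ?_) (hpos v)
    have h1 : 1 ≤ s ^ 2 := one_le_pow₀ hs
    nlinarith [sq_nonneg ‖v‖])
  rw [k1.2, k2.2] at hle
  have e1 : (Real.pi / (1 / 4)) ^ ((m : ℝ) / 2)
      = s ^ m * (Real.pi / (s ^ 2 / 4)) ^ ((m : ℝ) / 2) := by
    have : Real.pi / (1 / 4) = s ^ 2 * (Real.pi / (s ^ 2 / 4)) := by field_simp
    rw [this, Real.mul_rpow (by positivity) (by positivity)]
    congr 1
    rw [← Real.rpow_natCast s 2, ← Real.rpow_mul hs0.le, ← Real.rpow_natCast]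
    congr 1
    push_cast; ring
  have hC : 0 < (Real.pi / (s ^ 2 / 4)) ^ ((m : ℝ) / 2) := by positivity
  rw [e1, mul_comm (s ^ m), mul_assoc] at hle
  have := le_of_mul_le_mul_left hle hC
  have e2 : (4 : ℝ) * (s ^ 2 / 4) = s ^ 2 := by ring
  have e3 : (4 : ℝ) * (1 / 4) = 1 := by ring
  simpa only [e2, e3, div_one] using this

theorem cone_pd {m : ℕ} {ι : Type*} (S : Finset ι) (w : ι → Fin m → ℝ) (s : ℝ)
    (hs : 1 ≤ s) (g : (Fin m → ℝ) → ℝ) (hg : g ∈ cone m) :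
    ∑ i ∈ S, ∑ j ∈ S, g (s⁻¹ • (w i - w j)) ≤ s ^ m * ∑ i ∈ S, ∑ j ∈ S, g (w i - w j) := by
  have hcl : IsClosed {g : (Fin m → ℝ) → ℝ | ∑ i ∈ S, ∑ j ∈ S, g (s⁻¹ • (w i - w j)) ≤
      s ^ m * ∑ i ∈ S, ∑ j ∈ S, g (w i - w j)} := by
    apply isClosed_le <;> fun_prop
  refine closure_minimal ?_ hcl hg
  intro g hg
  have hg' := Subsemiring.mem_closure_iff.1 hg
  rw [Submonoid.closure_eq] at hg'
  induction hg' using AddSubmonoid.closure_induction with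
  | zero => simp
  | add x y hx hy h1 h2 =>
    simp only [Set.mem_ofPred_eq, Pi.add_apply, Finset.sum_add_distrib, mul_add] at *
    exact add_le_add (h1 (Subsemiring.mem_closure_iff.2 (by rwa [Submonoid.closure_eq])))
      (h2 (Subsemiring.mem_closure_iff.2 (by rwa [Submonoid.closure_eq])))
  | mem x hx =>
    obtain ⟨r, t, hr, ht, rfl⟩ := hx
    have h := gauss_pd S (fun i => WithLp.toLp 2 (fun l => √(t l) * w i l)) s hs
    have hn : ∀ i j, ‖(WithLp.toLp 2 (fun l => √(t l) * w i l) : EuclideanSpace ℝ (Fin m))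
        - WithLp.toLp 2 (fun l => √(t l) * w j l)‖ ^ 2 = ∑ l, t l * (w i l - w j l) ^ 2 := by
      intro i j
      rw [EuclideanSpace.real_norm_sq_eq]
      refine Finset.sum_congr rfl fun l _ => ?_
      simp only [PiLp.sub_apply, ← mul_sub, mul_pow, Real.sq_sqrt (ht l)]
    simp only [hn] at h
    have h2 := mul_le_mul_of_nonneg_left h hr
    simp only [Set.mem_ofPred_eq, ← Finset.mul_sum, Pi.smul_apply, Pi.sub_apply, smul_eq_mul]
    rw [mul_left_comm]
    refine le_of_eq_of_le ?_ h2
    congr 1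
    refine Finset.sum_congr rfl fun i _ => Finset.sum_congr rfl fun j _ => ?_
    congr 1
    rw [neg_div, Finset.sum_div]
    congr 1
    refine Finset.sum_congr rfl fun l _ => ?_
    rw [mul_pow, inv_pow]; ring

open Filter Topology in
theorem box_lemma {k : ℕ} (F G : (Fin k → ℤ) → ℝ) (hF : ∀ z, 0 ≤ F z) (hG : ∀ z, 0 ≤ G z)
    (hs : Summable G)
    (h : ∀ S : Finset (Fin k → ℤ), ∑ x ∈ S, ∑ y ∈ S, F (x - y) ≤ ∑ x ∈ S, ∑ y ∈ S, G (x - y)) :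
    Summable F ∧ ∑' z, F z ≤ ∑' z, G z := by
  have main : ∀ T : Finset (Fin k → ℤ), ∑ z ∈ T, F z ≤ ∑' z, G z := by
    intro T
    obtain ⟨R, hR⟩ : ∃ R : ℕ, ∀ z ∈ T, ∀ i, |z i| ≤ R := by
      refine ⟨∑ z ∈ T, ∑ i, (z i).natAbs, fun z hz i => ?_⟩
      rw [Int.abs_eq_natAbs]
      have h1 : (z i).natAbs ≤ ∑ i, (z i).natAbs :=
        Finset.single_le_sum (f := fun i => (z i).natAbs) (fun _ _ => Nat.zero_le _) (Finset.mem_univ i)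
      have h2 : ∑ i, (z i).natAbs ≤ ∑ z ∈ T, ∑ i, (z i).natAbs :=
        Finset.single_le_sum (f := fun z : Fin k → ℤ => ∑ i, (z i).natAbs)
          (fun _ _ => Nat.zero_le _) hz
      exact_mod_cast h1.trans h2
    let B : ℕ → Finset (Fin k → ℤ) := fun N => Finset.Icc (fun _ => -(N : ℤ)) (fun _ => (N : ℤ))
    have hB : ∀ N z, z ∈ B N ↔ ∀ i, |z i| ≤ N := by
      intro N z
      simp only [B, Finset.mem_Icc, Pi.le_def, abs_le, forall_and]
    have hcard : ∀ N, ((B N).card : ℝ) = (2 * N + 1 : ℝ) ^ k := by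
      intro N
      have : (B N).card = (2 * N + 1) ^ k := by
        simp only [B, Pi.card_Icc, Int.card_Icc, Finset.prod_const, Finset.card_univ, Fintype.card_fin]
        congr 1
        omega
      rw [this]; push_cast; rfl
    have hN : ∀ N : ℕ, (2 * N + 1 : ℝ) ^ k * ∑ z ∈ T, F z
        ≤ (2 * ((N + R : ℕ) : ℝ) + 1) ^ k * ∑' z, G z := by
      intro N
      calc (2 * N + 1 : ℝ) ^ k * ∑ z ∈ T, F z = ∑ y ∈ B N, ∑ z ∈ T, F z := by
            rw [Finset.sum_const, nsmul_eq_mul, hcard]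
        _ ≤ ∑ y ∈ B N, ∑ x ∈ B (N + R), F (x - y) := by
            refine Finset.sum_le_sum fun y hy => ?_
            have : ∑ z ∈ T, F z = ∑ x ∈ T.map (addRightEmbedding y), F (x - y) := by
              simp
            rw [this]
            refine Finset.sum_le_sum_of_subset_of_nonneg ?_ fun _ _ _ => hF _
            intro x hx
            simp only [Finset.mem_map, addRightEmbedding_apply] at hx
            obtain ⟨z, hz, rfl⟩ := hx
            rw [hB] at hy ⊢
            intro i
            have := abs_add_le (z i) (y i)
            have h1 := hR z hz i
            have h2 := hy i
            simp only [Pi.add_apply]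
            push_cast
            linarith
        _ ≤ ∑ y ∈ B (N + R), ∑ x ∈ B (N + R), F (x - y) := by
            refine Finset.sum_le_sum_of_subset_of_nonneg ?_ fun _ _ _ =>
              Finset.sum_nonneg fun _ _ => hF _
            intro x hx
            rw [hB] at hx ⊢
            intro i
            have := hx i
            push_cast
            linarith
        _ ≤ ∑ y ∈ B (N + R), ∑ x ∈ B (N + R), G (x - y) := by
            rw [Finset.sum_comm]
            refine (h _).trans (le_of_eq ?_)
            rw [Finset.sum_comm]
        _ ≤ ∑ y ∈ B (N + R), ∑' z, G z := by
            refine Finset.sum_le_sum fun y _ => ?_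
            have : ∑ x ∈ B (N + R), G (x - y)
                = ∑ x ∈ (B (N + R)).map (addRightEmbedding (-y)), G x := by
              simp [sub_eq_add_neg]
            rw [this]
            exact hs.sum_le_tsum _ fun _ _ => hG _
        _ = _ := by rw [Finset.sum_const, nsmul_eq_mul, hcard]
    have hlim : Tendsto (fun N : ℕ => ((2 * N + 1 : ℝ) / (2 * ((N + R : ℕ) : ℝ) + 1)) ^ k
        * ∑ z ∈ T, F z) atTop (𝓝 (1 ^ k * ∑ z ∈ T, F z)) := by
      refine Tendsto.mul_const _ (Tendsto.pow ?_ k)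
      have h0 : Tendsto (fun N : ℕ => 1 - (2 * R : ℝ) / (2 * ((N + R : ℕ) : ℝ) + 1)) atTop
          (𝓝 (1 - 0)) := by
        refine tendsto_const_nhds.sub (Tendsto.const_div_atTop ?_ _)
        refine tendsto_atTop_mono (fun N : ℕ => ?_) tendsto_natCast_atTop_atTop
        push_cast
        have : (0 : ℝ) ≤ R := by positivity
        have : (0 : ℝ) ≤ N := by positivity
        linarith
      rw [sub_zero] at h0
      refine h0.congr fun N => ?_
      have : (2 * ((N + R : ℕ) : ℝ) + 1) ≠ 0 := by positivity
      field_simp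
      push_cast; ring
    rw [one_pow, one_mul] at hlim
    refine le_of_tendsto' hlim fun N => ?_
    rw [div_pow, div_mul_eq_mul_div, div_le_iff₀ (by positivity), mul_comm (∑' z, G z)]
    exact hN N
  have hsF : Summable F := summable_of_sum_le hF main
  exact ⟨hsF, hsF.tsum_le_of_sum_le main⟩

theorem pnorm_rpow (p : ℝ) (hp : 1 ≤ p) {m : ℕ} (x : Fin m → ℝ) :
    pnorm p x ^ p = ∑ i, |x i| ^ p := by
  unfold pnorm
  have h : 0 ≤ ∑ i, |x i| ^ p := Finset.sum_nonneg fun i _ => by positivity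
  rw [← Real.rpow_mul h, one_div, inv_mul_cancel₀ (by linarith), Real.rpow_one]

theorem stmt_14 (m k : ℕ) (p a : ℝ) (hp1 : 1 ≤ p) (hp2 : p ≤ 2) (ha : 1 ≤ a)
    (b : Fin k → (Fin m → ℝ)) (hb : LinearIndependent ℝ b)
    (L : Set (Fin m → ℝ)) (hL : L = {v | ∃ z : Fin k → ℤ, v = ∑ i, z i • b i})
    (hsum : Summable (fun x : L => Real.exp (-pnorm p (x : Fin m → ℝ) ^ p))) :
    (∑' x : {v : Fin m → ℝ // v ∈ L ∧ a * ((m : ℝ) / p) ^ (1 / p) ≤ pnorm p v},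
        Real.exp (-pnorm p (x : Fin m → ℝ) ^ p))
      ≤ (Real.exp 1 * a ^ p * Real.exp (-a ^ p)) ^ ((m : ℝ) / p) *
          ∑' x : L, Real.exp (-pnorm p (x : Fin m → ℝ) ^ p) := by
  have ha0 : 0 < a := by linarith
  have hp0 : 0 < p := by linarith
  let f : (Fin m → ℝ) → ℝ := fun x => Real.exp (-∑ i, |x i| ^ p)
  have hf : ∀ x : Fin m → ℝ, Real.exp (-pnorm p x ^ p) = f x := fun x => by
    rw [pnorm_rpow p hp1]
  let φ : (Fin k → ℤ) → (Fin m → ℝ) := fun z => ∑ i, z i • b i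
  have hφsub : ∀ x y, φ (x - y) = φ x - φ y := fun x y => by
    simp only [φ, Pi.sub_apply, sub_smul, Finset.sum_sub_distrib]
  have hφ : Function.Injective φ := by
    intro x y hxy
    have h0 : φ (x - y) = 0 := by rw [hφsub, hxy, sub_self]
    have h1 : ∑ i, ((x i - y i : ℤ) : ℝ) • b i = 0 := by
      rw [← h0]
      refine Finset.sum_congr rfl fun i _ => ?_
      rw [Int.cast_smul_eq_zsmul]; rfl
    funext i
    have h2 := Fintype.linearIndependent_iff.1 hb _ h1 i
    have h3 : x i - y i = 0 := by exact_mod_cast h2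
    linarith
  have hLr : L = Set.range φ := by
    rw [hL]; ext v
    simp only [Set.mem_ofPred_eq, Set.mem_range, φ, eq_comm]
  subst hLr
  clear hL
  simp only [hf] at hsum ⊢
  let e : (Fin k → ℤ) ≃ Set.range φ := Equiv.ofInjective φ hφ
  have hsz : Summable (fun z => f (φ z)) := (e.summable_iff (f := fun x : Set.range φ => f x)).2 hsum
  have hfpos : ∀ x, 0 < f x := fun x => Real.exp_pos _
  obtain ⟨hs1, hs2⟩ := box_lemma (fun z => f (a⁻¹ • φ z)) (fun z => a ^ m * f (φ z))
    (fun z => (hfpos _).le) (fun z => mul_nonneg (by positivity) (hfpos _).le)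
    (hsz.mul_left _) (fun S => by
      simp only [hφsub, ← Finset.mul_sum]
      exact cone_pd S φ a ha f (cone_main p hp1 hp2))
  rw [tsum_mul_left] at hs2
  have hsL : Summable (fun x : Set.range φ => f (a⁻¹ • (x : Fin m → ℝ))) :=
    (e.summable_iff (f := fun x : Set.range φ => f (a⁻¹ • (x : Fin m → ℝ)))).1 hs1
  have t1 : ∑' z, f (a⁻¹ • φ z) = ∑' x : Set.range φ, f (a⁻¹ • (x : Fin m → ℝ)) :=
    e.tsum_eq (fun x : Set.range φ => f (a⁻¹ • (x : Fin m → ℝ)))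
  have t2 : ∑' z, f (φ z) = ∑' x : Set.range φ, f x :=
    e.tsum_eq (fun x : Set.range φ => f x)
  rw [t1, t2] at hs2
  let C : ℝ := Real.exp (-((a ^ p - 1) * (m / p)))
  let ψ : {v : Fin m → ℝ // v ∈ Set.range φ ∧ a * ((m : ℝ) / p) ^ (1 / p) ≤ pnorm p v} →
    Set.range φ := fun x => ⟨x.1, x.2.1⟩
  have hψ : Function.Injective ψ := fun x y h => Subtype.ext (congrArg (fun u => u.1) h)
  have hap : 1 ≤ a ^ p := Real.one_le_rpow ha hp0.le
  have hpt : ∀ x : {v : Fin m → ℝ // v ∈ Set.range φ ∧ a * ((m : ℝ) / p) ^ (1 / p) ≤ pnorm p v},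
      f x ≤ C * f (a⁻¹ • (ψ x : Fin m → ℝ)) := by
    rintro ⟨x, hx, hr⟩
    have hr2 := Real.rpow_le_rpow (by positivity) hr hp0.le
    rw [pnorm_rpow p hp1, Real.mul_rpow ha0.le (by positivity), ← Real.rpow_mul (by positivity),
      one_div, inv_mul_cancel₀ hp0.ne', Real.rpow_one] at hr2
    simp only [f, C, ψ]
    rw [← Real.exp_add, Real.exp_le_exp]
    have : ∑ i, |(a⁻¹ • x) i| ^ p = (a ^ p)⁻¹ * ∑ i, |x i| ^ p := by
      rw [Finset.mul_sum]
      refine Finset.sum_congr rfl fun i _ => ?_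
      rw [Pi.smul_apply, smul_eq_mul, abs_mul, Real.mul_rpow (abs_nonneg _) (abs_nonneg _),
        abs_of_pos (inv_pos.2 ha0), Real.inv_rpow ha0.le]
    rw [this]
    generalize ∑ i, |x i| ^ p = X at *
    generalize a ^ p = A at *
    have hA : 0 < A := by linarith
    have h3 : (m : ℝ) / p ≤ A⁻¹ * X := by
      rw [inv_mul_eq_div, le_div_iff₀ hA]; linarith
    have h4 : X = A * (A⁻¹ * X) := by field_simp
    have h5 := mul_le_mul_of_nonneg_left h3 (sub_nonneg.2 hap)
    nlinarith
  have hsR : Summable fun x => C * f (a⁻¹ • (ψ x : Fin m → ℝ)) :=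
    (hsL.comp_injective hψ).mul_left C
  have hC0 : 0 ≤ C := (Real.exp_pos _).le
  have hconst : (Real.exp 1 * a ^ p * Real.exp (-a ^ p)) ^ ((m : ℝ) / p) = C * a ^ m := by
    have h1 : Real.exp 1 * a ^ p * Real.exp (-a ^ p) = Real.exp (-(a ^ p - 1)) * a ^ p := by
      rw [mul_right_comm, ← Real.exp_add]; ring_nf
    rw [h1, Real.mul_rpow (by positivity) (by positivity), ← Real.exp_mul, ← Real.rpow_mul ha0.le,
      mul_div_cancel₀ _ hp0.ne', Real.rpow_natCast, neg_mul]
  calc _ ≤ ∑' x, C * f (a⁻¹ • (ψ x : Fin m → ℝ)) :=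
        Summable.tsum_le_tsum hpt
          (Summable.of_nonneg_of_le (fun x => (hfpos _).le) hpt hsR) hsR
    _ = C * ∑' x, f (a⁻¹ • (ψ x : Fin m → ℝ)) := tsum_mul_left
    _ ≤ C * ∑' x : Set.range φ, f (a⁻¹ • (x : Fin m → ℝ)) := by
        refine mul_le_mul_of_nonneg_left ?_ hC0
        exact tsum_comp_le_tsum_of_inj hsL (fun x => (hfpos _).le) hψ
    _ ≤ C * (a ^ m * ∑' x : Set.range φ, f x) := mul_le_mul_of_nonneg_left hs2 hC0
    _ = _ := by rw [hconst, mul_assoc]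
end

section
/- For any lattice $\mathcal{L} \subset \mathbb{R}^m$, any $1 \le p \le 2$, any $\vec{t} \in \mathbb{R}^m$, and with $f_p(\vec{x}) = e^{-\|\vec{x}\|_p^p}$: the shifted mass is bounded above by the centered mass, $f_p(\mathcal{L} + \vec{t}) \le f_p(\mathcal{L})$, and moreover for the Kannan embedding with scaling parameter $\alpha > 0$, the total supergaussian mass factors as an upper bound: $f_p(\mathcal{L}^\dagger) = \sum_{k \in \mathbb{Z}} f_p(k) \cdot f_p\big(\tfrac{1}{\alpha}(\mathcal{L} - k\vec{t})\big) \le \Big(\sum_{k \in \mathbb{Z}} e^{-|k|^p}\Big) \cdot f_p\big(\tfrac{1}{\alpha}\mathcal{L}\big)$, where $\mathcal{L}^\dagger := \{(\tfrac{1}{\alpha}(\vec{u} - k\vec{t}), k) : \vec{u} \in \mathcal{L}, k \in \mathbb{Z}\}$. -/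
/-- Real positive semidefinite kernel on a finite index type. -/
def PSDK {ι : Type} [Fintype ι] (K : ι → ι → ℝ) : Prop :=
  (∀ i j, K i j = K j i) ∧ ∀ c : ι → ℝ, 0 ≤ ∑ i, ∑ j, c i * c j * K i j

theorem psdk_iff {ι : Type} [Fintype ι] (K : ι → ι → ℝ) :
    PSDK K ↔ (Matrix.of K).PosSemidef := by
  rw [Matrix.posSemidef_iff_dotProduct_mulVec]
  unfold PSDK
  refine and_congr ?_ (forall_congr' fun c => ?_)
  · constructor
    · intro h
      ext i j
      simp [h i j]
    · intro h i j
      have := congrFun (congrFun h j) i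
      simpa using this
  · simp only [dotProduct, Matrix.mulVec, Finset.mul_sum, Matrix.of_apply, Pi.star_apply, star_trivial]
    have : ∀ i j, c i * c j * K i j = c i * (K i j * c j) := fun i j => by ring
    simp only [this]

theorem PSDK.mul {ι : Type} [Fintype ι] {K M : ι → ι → ℝ} (hK : PSDK K) (hM : PSDK M) :
    PSDK (fun i j => K i j * M i j) := by
  rw [psdk_iff] at *
  exact hK.hadamard hM

theorem PSDK.sum {ι κ : Type} [Fintype ι] (s : Finset κ) {K : κ → ι → ι → ℝ}
    (hK : ∀ a ∈ s, PSDK (K a)) : PSDK (fun i j => ∑ a ∈ s, K a i j) := by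
  refine ⟨fun i j => Finset.sum_congr rfl fun a ha => (hK a ha).1 i j, fun c => ?_⟩
  have : ∑ i, ∑ j, c i * c j * ∑ a ∈ s, K a i j = ∑ a ∈ s, ∑ i, ∑ j, c i * c j * K a i j := by
    simp only [Finset.mul_sum]
    rw [Finset.sum_comm]
    conv_rhs => rw [Finset.sum_comm]
    rw [Finset.sum_comm]
    refine Finset.sum_congr rfl fun i _ => ?_
    rw [Finset.sum_comm]
  rw [this]
  exact Finset.sum_nonneg fun a ha => (hK a ha).2 c

theorem PSDK.rankone {ι : Type} [Fintype ι] (d : ι → ℝ) : PSDK (fun i j => d i * d j) := by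
  refine ⟨fun i j => mul_comm _ _, fun c => ?_⟩
  have : ∑ i, ∑ j, c i * c j * (d i * d j) = (∑ i, c i * d i) * ∑ j, c j * d j := by
    rw [Finset.sum_mul_sum]
    exact Finset.sum_congr rfl fun i _ => Finset.sum_congr rfl fun j _ => by ring
  rw [this]
  exact mul_self_nonneg _

theorem PSDK.smul {ι : Type} [Fintype ι] {K : ι → ι → ℝ} (hK : PSDK K) {r : ℝ} (hr : 0 ≤ r) :
    PSDK (fun i j => r * K i j) := by
  refine ⟨fun i j => by beta_reduce; rw [hK.1 i j], fun c => ?_⟩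
  have : ∑ i, ∑ j, c i * c j * (r * K i j) = r * ∑ i, ∑ j, c i * c j * K i j := by
    simp only [Finset.mul_sum]
    exact Finset.sum_congr rfl fun i _ => Finset.sum_congr rfl fun j _ => by ring
  rw [this]
  exact mul_nonneg hr (hK.2 c)

theorem PSDK.pow {ι : Type} [Fintype ι] {K : ι → ι → ℝ} (hK : PSDK K) (n : ℕ) :
    PSDK (fun i j => K i j ^ n) := by
  induction n with
  | zero => simpa using PSDK.rankone (fun _ : ι => (1 : ℝ))
  | succ n ih => simpa only [pow_succ] using ih.mul hK

theorem PSDK.exp {ι : Type} [Fintype ι] {K : ι → ι → ℝ} (hK : PSDK K) :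
    PSDK (fun i j => Real.exp (K i j)) := by
  refine ⟨fun i j => by beta_reduce; rw [hK.1 i j], fun c => ?_⟩
  have hpart : ∀ n : ℕ, PSDK (fun i j => ∑ a ∈ Finset.range n, ((a.factorial : ℝ)⁻¹ * K i j ^ a)) :=
    fun n => PSDK.sum _ fun a _ => (hK.pow a).smul (by positivity)
  have hlim : Filter.Tendsto (fun n : ℕ => ∑ i, ∑ j, c i * c j *
      ∑ a ∈ Finset.range n, ((a.factorial : ℝ)⁻¹ * K i j ^ a)) Filter.atTop
      (nhds (∑ i, ∑ j, c i * c j * Real.exp (K i j))) := by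
    refine tendsto_finsetSum _ fun i _ => tendsto_finsetSum _ fun j _ => ?_
    refine Filter.Tendsto.const_mul _ ?_
    have := (NormedSpace.expSeries_div_hasSum_exp (K i j)).tendsto_sum_nat
    rw [← Real.exp_eq_exp_ℝ] at this
    simpa only [div_eq_inv_mul] using this
  exact ge_of_tendsto' hlim fun n => (hpart n).2 c

/-- Schoenberg. -/
theorem PSDK.schoenberg {ι : Type} [Fintype ι] (ψ : ι → ℝ) (D : ι → ι → ℝ)
    (h : PSDK (fun i j => ψ i + ψ j - D i j)) : PSDK (fun i j => Real.exp (-(D i j))) := by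
  have := h.exp.mul (PSDK.rankone (fun i => Real.exp (-(ψ i))))
  convert this using 3 with i j
  rw [← Real.exp_add, ← Real.exp_add]
  congr 1
  ring

open MeasureTheory Set

theorem cos_integrable (p : ℝ) (hp1 : 1 ≤ p) (hp2 : p < 2) (x : ℝ) :
    IntegrableOn (fun s : ℝ => (1 - Real.cos (x * s)) * s ^ (-1 - p)) (Ioi 0) := by
  have hm : ∀ S : Set ℝ, AEStronglyMeasurable (fun s : ℝ => (1 - Real.cos (x * s)) * s ^ (-1 - p))
      (volume.restrict S) := fun S => by
    apply Measurable.aestronglyMeasurable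
    fun_prop
  rw [← Ioc_union_Ioi_eq_Ioi zero_le_one]
  refine IntegrableOn.union ?_ ?_
  · have h1 : IntegrableOn (fun s : ℝ => x ^ 2 / 2 * s ^ (1 - p)) (Ioc 0 1) := by
      have := intervalIntegral.intervalIntegrable_rpow' (a := 0) (b := 1) (r := 1 - p) (by linarith)
      rw [intervalIntegrable_iff_integrableOn_Ioc_of_le zero_le_one] at this
      exact this.const_mul _
    refine Integrable.mono' h1 (hm _) ?_
    filter_upwards [ae_restrict_mem measurableSet_Ioc] with s hs
    have hs0 : 0 < s := hs.1
    have h2 : 0 ≤ 1 - Real.cos (x * s) := by linarith [Real.cos_le_one (x * s)]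
    have h3 := Real.one_sub_sq_div_two_le_cos (x := x * s)
    rw [Real.norm_of_nonneg (by positivity)]
    have h4 : s ^ (1 - p) = s ^ 2 * s ^ (-1 - p) := by
      rw [← Real.rpow_natCast, ← Real.rpow_add hs0]
      congr 1; push_cast; ring
    rw [h4, ← mul_assoc]
    gcongr
    nlinarith
  · have h1 : IntegrableOn (fun s : ℝ => 2 * s ^ (-1 - p)) (Ioi 1) :=
      (integrableOn_Ioi_rpow_of_lt (by linarith) one_pos).const_mul _
    refine Integrable.mono' h1 (hm _) ?_
    filter_upwards [ae_restrict_mem measurableSet_Ioi] with s hs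
    have hs0 : 0 < s := lt_trans one_pos hs
    have h2 : 0 ≤ 1 - Real.cos (x * s) := by linarith [Real.cos_le_one (x * s)]
    rw [Real.norm_of_nonneg (by positivity)]
    gcongr
    linarith [Real.neg_one_le_cos (x * s)]

theorem cos_scaling (p : ℝ) (hp1 : 1 ≤ p) (x : ℝ) :
    ∫ s in Ioi (0:ℝ), (1 - Real.cos (x * s)) * s ^ (-1 - p) =
      |x| ^ p * ∫ s in Ioi (0:ℝ), (1 - Real.cos s) * s ^ (-1 - p) := by
  by_cases hx : x = 0
  · subst hx
    simp [Real.zero_rpow (by linarith : p ≠ 0)]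
  have hx0 : 0 < |x| := abs_pos.mpr hx
  have h := integral_comp_mul_left_Ioi (fun s => (1 - Real.cos s) * s ^ (-1 - p)) 0 hx0
  rw [mul_zero, smul_eq_mul] at h
  have h2 : ∫ s in Ioi (0:ℝ), (1 - Real.cos (|x| * s)) * (|x| * s) ^ (-1 - p) =
      |x| ^ (-1 - p) * ∫ s in Ioi (0:ℝ), (1 - Real.cos (x * s)) * s ^ (-1 - p) := by
    rw [← integral_const_mul]
    refine setIntegral_congr_fun measurableSet_Ioi fun s hs => ?_
    have hs0 : 0 < s := hs
    have : Real.cos (|x| * s) = Real.cos (x * s) := by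
      rw [← Real.cos_abs (x * s), abs_mul, abs_of_pos hs0]
    simp only [this, Real.mul_rpow hx0.le hs0.le]
    ring
  rw [h2] at h
  have hne : |x| ^ (-1 - p) ≠ 0 := (Real.rpow_pos_of_pos hx0 _).ne'
  have h4 : |x| ^ (-1 - p) * |x| ^ p = |x|⁻¹ := by
    rw [← Real.rpow_add hx0, ← Real.rpow_neg_one]; congr 1; ring
  apply mul_left_cancel₀ hne
  rw [h, ← mul_assoc, h4]

theorem cos_const_pos (p : ℝ) (hp1 : 1 ≤ p) (hp2 : p < 2) :
    0 < ∫ s in Ioi (0:ℝ), (1 - Real.cos s) * s ^ (-1 - p) := by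
  have hi := cos_integrable p hp1 hp2 1
  simp only [one_mul] at hi
  rw [setIntegral_pos_iff_support_of_nonneg_ae _ hi]
  · have hsub : Ioo (0:ℝ) 1 ⊆ (Function.support fun s : ℝ => (1 - Real.cos s) * s ^ (-1 - p)) ∩ Ioi 0 := by
      intro s hs
      refine ⟨?_, hs.1⟩
      have h1 : Real.cos s < 1 := by
        rw [← Real.cos_zero]
        exact Real.cos_lt_cos_of_nonneg_of_le_pi le_rfl (by linarith [hs.2, Real.pi_gt_three]) hs.1
      have h2 := Real.rpow_pos_of_pos hs.1 (-1 - p)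
      exact (mul_pos (by linarith) h2).ne'
    refine lt_of_lt_of_le ?_ (measure_mono hsub)
    simp
  · filter_upwards [ae_restrict_mem measurableSet_Ioi] with s hs
    have hs0 : 0 < s := hs
    have h2 : 0 ≤ 1 - Real.cos s := by linarith [Real.cos_le_one s]
    simp only [Pi.zero_apply]
    positivity

theorem abs_rpow_psdk {ι : Type} [Fintype ι] (p : ℝ) (hp1 : 1 ≤ p) (hp2 : p ≤ 2) (x : ι → ℝ) :
    PSDK (fun i j => |x i| ^ p + |x j| ^ p - |x i - x j| ^ p) := by
  rcases hp2.lt_or_eq with hp2 | rfl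
  swap
  · have := (PSDK.rankone x).smul (r := 2) (by norm_num)
    convert this using 3 with i j
    norm_num [sq_abs]
    ring
  refine ⟨fun i j => by beta_reduce; rw [abs_sub_comm]; ring, fun c => ?_⟩
  have hC := cos_const_pos p hp1 hp2
  set C := ∫ s in Ioi (0:ℝ), (1 - Real.cos s) * s ^ (-1 - p) with hCdef
  refine nonneg_of_mul_nonneg_left (b := C) ?_ hC
  have hI := fun y => cos_integrable p hp1 hp2 y
  have key : (∑ i, ∑ j, c i * c j * (|x i| ^ p + |x j| ^ p - |x i - x j| ^ p)) * C =
      ∫ s in Ioi (0:ℝ), ∑ i, ∑ j, c i * c j * ((1 - Real.cos (x i * s)) * s ^ (-1 - p) +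
        (1 - Real.cos (x j * s)) * s ^ (-1 - p) - (1 - Real.cos ((x i - x j) * s)) * s ^ (-1 - p)) := by
    have hij : ∀ i j, Integrable (fun s => c i * c j * ((1 - Real.cos (x i * s)) * s ^ (-1 - p) +
        (1 - Real.cos (x j * s)) * s ^ (-1 - p) - (1 - Real.cos ((x i - x j) * s)) * s ^ (-1 - p)))
        (volume.restrict (Ioi (0:ℝ))) := fun i j =>
      (((hI (x i)).add (hI (x j))).sub (hI (x i - x j))).const_mul _
    rw [integral_finsetSum _ fun i _ => integrable_finsetSum _ fun j _ => hij i j, Finset.sum_mul]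
    refine Finset.sum_congr rfl fun i _ => ?_
    rw [integral_finsetSum _ fun j _ => hij i j, Finset.sum_mul]
    refine Finset.sum_congr rfl fun j _ => ?_
    rw [integral_const_mul, integral_sub, integral_add (hI _) (hI _), cos_scaling p hp1,
      cos_scaling p hp1, cos_scaling p hp1]
    · ring
    · exact (hI (x i)).add (hI (x j))
    · exact hI _
  rw [key]
  refine setIntegral_nonneg measurableSet_Ioi fun s hs => ?_
  have hs0 : 0 < s := hs
  have : ∑ i, ∑ j, c i * c j * ((1 - Real.cos (x i * s)) * s ^ (-1 - p) +
        (1 - Real.cos (x j * s)) * s ^ (-1 - p) - (1 - Real.cos ((x i - x j) * s)) * s ^ (-1 - p)) =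
      s ^ (-1 - p) * ((∑ i, ∑ j, c i * c j * ((1 - Real.cos (x i * s)) * (1 - Real.cos (x j * s)))) +
       ∑ i, ∑ j, c i * c j * (Real.sin (x i * s) * Real.sin (x j * s))) := by
    rw [← Finset.sum_add_distrib, Finset.mul_sum]
    refine Finset.sum_congr rfl fun i _ => ?_
    rw [← Finset.sum_add_distrib, Finset.mul_sum]
    refine Finset.sum_congr rfl fun j _ => ?_
    rw [sub_mul (x i), Real.cos_sub]
    ring
  rw [this]
  exact mul_nonneg (by positivity) (add_nonneg ((PSDK.rankone fun i => 1 - Real.cos (x i * s)).2 c)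
    ((PSDK.rankone fun i => Real.sin (x i * s)).2 c))

/-- The supergaussian. -/
noncomputable def sg {m : ℕ} (p : ℝ) (x : Fin m → ℝ) : ℝ := Real.exp (-(∑ i, |x i| ^ p))

theorem sg_psdk {ι : Type} [Fintype ι] {m : ℕ} (p : ℝ) (hp1 : 1 ≤ p) (hp2 : p ≤ 2)
    (x : ι → Fin m → ℝ) : PSDK (fun i j => sg p (x i - x j)) := by
  refine PSDK.schoenberg (fun i => ∑ a, |x i a| ^ p) (fun i j => ∑ a, |(x i - x j) a| ^ p) ?_
  have := PSDK.sum Finset.univ (fun a _ => abs_rpow_psdk p hp1 hp2 (fun i => x i a))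
  simpa only [Finset.sum_sub_distrib, Finset.sum_add_distrib, Pi.sub_apply] using this

theorem sg_neg {m : ℕ} (p : ℝ) (x : Fin m → ℝ) : sg p (-x) = sg p x := by
  simp [sg]

theorem sg_pos {m : ℕ} (p : ℝ) (x : Fin m → ℝ) : 0 < sg p x := Real.exp_pos _

theorem sg_pair {m k : ℕ} (p : ℝ) (hp1 : 1 ≤ p) (hp2 : p ≤ 2)
    (g : (Fin k → ℤ) →+ (Fin m → ℝ)) (t : Fin m → ℝ) (B : Finset (Fin k → ℤ)) :
    ∑ x ∈ B, ∑ y ∈ B, sg p (g (x - y) + t) ≤ ∑ x ∈ B, ∑ y ∈ B, sg p (g (x - y)) := by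
  have h := (sg_psdk (ι := Bool × B) p hp1 hp2
    (fun u => g u.2 + if u.1 then t else 0)).2 (fun u => if u.1 then 1 else -1)
  simp only [Fintype.sum_prod_type, Fintype.sum_bool, if_true, Bool.false_eq_true, if_false,
    Finset.sum_add_distrib] at h
  have e1 : ∀ x y : B, sg p (g x + t - (g y + t)) = sg p (g (x - y)) := fun x y => by
    rw [map_sub]; congr 1; abel
  have e2 : ∀ x y : B, sg p (g x + 0 - (g y + 0)) = sg p (g (x - y)) := fun x y => by
    rw [map_sub]; congr 1; abel
  have e3 : ∀ x y : B, sg p (g x + t - (g y + 0)) = sg p (g (x - y) + t) := fun x y => by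
    rw [map_sub]; congr 1; abel
  have e4 : ∀ x y : B, sg p (g x + 0 - (g y + t)) = sg p (g (y - x) + t) := fun x y => by
    rw [← sg_neg, map_sub]; congr 1; abel
  simp only [e1, e2, e3, e4] at h
  have e5 : ∑ x : B, ∑ y : B, sg p (g (y - x) + t) = ∑ x : B, ∑ y : B, sg p (g (x - y) + t) :=
    Finset.sum_comm
  simp only [one_mul, mul_one, neg_mul, mul_neg, neg_neg, Finset.sum_neg_distrib, e5] at h
  have c1 : ∑ x ∈ B, ∑ y ∈ B, sg p (g (x - y) + t) = ∑ x : B, ∑ y : B, sg p (g (x - y) + t) := by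
    rw [← Finset.sum_coe_sort]
    refine Finset.sum_congr rfl fun x _ => ?_
    rw [← Finset.sum_coe_sort]
  have c2 : ∑ x ∈ B, ∑ y ∈ B, sg p (g (x - y)) = ∑ x : B, ∑ y : B, sg p (g (x - y)) := by
    rw [← Finset.sum_coe_sort]
    refine Finset.sum_congr rfl fun x _ => ?_
    rw [← Finset.sum_coe_sort]
  rw [c1, c2]
  linarith

/-- The box of radius n. -/
noncomputable def bx (k n : ℕ) : Finset (Fin k → ℤ) :=
  Fintype.piFinset fun _ => Finset.Icc (-(n : ℤ)) n

theorem bx_card (k n : ℕ) : (bx k n).card = (2 * n + 1) ^ k := by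
  simp only [bx, Fintype.card_piFinset_const, Int.card_Icc]
  congr 1
  omega

theorem mem_bx {k n : ℕ} {z : Fin k → ℤ} : z ∈ bx k n ↔ ∀ i, -(n : ℤ) ≤ z i ∧ z i ≤ n := by
  simp [bx, Fintype.mem_piFinset]

theorem sg_box {m k : ℕ} (p : ℝ) (hp1 : 1 ≤ p) (hp2 : p ≤ 2)
    (g : (Fin k → ℤ) →+ (Fin m → ℝ)) (t : Fin m → ℝ) (hs : Summable fun z => sg p (g z))
    (M N : ℕ) :
    ((2 * N + 1 : ℝ)) ^ k * ∑ z ∈ bx k M, sg p (g z + t) ≤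
      (2 * (N + M) + 1 : ℝ) ^ k * ∑' z, sg p (g z) := by
  have h1 := sg_pair p hp1 hp2 g t (bx k (N + M))
  have h2 : ∑ x ∈ bx k (N + M), ∑ y ∈ bx k (N + M), sg p (g (x - y)) ≤
      (2 * (N + M) + 1 : ℝ) ^ k * ∑' z, sg p (g z) := by
    have : ∀ x ∈ bx k (N + M), ∑ y ∈ bx k (N + M), sg p (g (x - y)) ≤ ∑' z, sg p (g z) := by
      intro x _
      rw [← Finset.sum_image (s := bx k (N + M)) (g := fun y => x - y) (f := fun z => sg p (g z))
        (fun a _ b _ h => sub_right_injective h)]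
      exact hs.sum_le_tsum _ fun z _ => (sg_pos p _).le
    refine (Finset.sum_le_card_nsmul _ _ _ this).trans_eq ?_
    rw [bx_card, nsmul_eq_mul]
    push_cast
    ring
  have h3 : ((2 * N + 1 : ℝ)) ^ k * ∑ z ∈ bx k M, sg p (g z + t) ≤
      ∑ x ∈ bx k (N + M), ∑ y ∈ bx k (N + M), sg p (g (x - y) + t) := by
    rw [Finset.sum_comm]
    have hsub : bx k N ⊆ bx k (N + M) := by
      intro z hz
      rw [mem_bx] at hz ⊢
      intro i
      have := hz i
      push_cast
      omega
    refine le_trans ?_ (Finset.sum_le_sum_of_subset_of_nonneg hsub fun y _ _ =>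
      Finset.sum_nonneg fun x _ => (sg_pos p _).le)
    have : ∀ y ∈ bx k N, ∑ z ∈ bx k M, sg p (g z + t) ≤
        ∑ x ∈ bx k (N + M), sg p (g (x - y) + t) := by
      intro y hy
      have e : ∑ z ∈ bx k M, sg p (g z + t) =
          ∑ x ∈ (bx k M).image (fun z => z + y), sg p (g (x - y) + t) := by
        rw [Finset.sum_image (fun a _ b _ h => add_left_injective y h)]
        simp
      rw [e]
      refine Finset.sum_le_sum_of_subset_of_nonneg ?_ fun x _ _ => (sg_pos p _).le
      intro x hx
      obtain ⟨z, hz, rfl⟩ := Finset.mem_image.mp hx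
      rw [mem_bx] at hz hy ⊢
      intro i
      have := hz i
      have := hy i
      simp only [Pi.add_apply]
      push_cast
      omega
    refine le_trans (le_of_eq ?_) (Finset.card_nsmul_le_sum _ _ _ this)
    rw [bx_card, nsmul_eq_mul]
    push_cast
    ring
  exact h3.trans (h1.trans h2)

theorem sg_box_lim {m k : ℕ} (p : ℝ) (hp1 : 1 ≤ p) (hp2 : p ≤ 2)
    (g : (Fin k → ℤ) →+ (Fin m → ℝ)) (t : Fin m → ℝ) (hs : Summable fun z => sg p (g z))
    (M : ℕ) : ∑ z ∈ bx k M, sg p (g z + t) ≤ ∑' z, sg p (g z) := by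
  have hb : ∀ N : ℕ, ∑ z ∈ bx k M, sg p (g z + t) ≤
      (1 + 2 * M * ((2 * N + 1 : ℝ))⁻¹) ^ k * ∑' z, sg p (g z) := by
    intro N
    have h := sg_box p hp1 hp2 g t hs M N
    have hpos : (0:ℝ) < 2 * N + 1 := by positivity
    have e : (1 + 2 * M * ((2 * N + 1 : ℝ))⁻¹) = (2 * (N + M) + 1 : ℝ) / (2 * N + 1) := by
      field_simp
      ring
    rw [e, div_pow, div_mul_eq_mul_div, le_div_iff₀ (by positivity), mul_comm]
    exact h
  have hlim : Filter.Tendsto (fun N : ℕ => (1 + 2 * M * ((2 * N + 1 : ℝ))⁻¹) ^ k * ∑' z, sg p (g z))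
      Filter.atTop (nhds ((1 + 2 * M * 0) ^ k * ∑' z, sg p (g z))) := by
    refine Filter.Tendsto.mul_const _ (Filter.Tendsto.pow (Filter.Tendsto.const_add _
      (Filter.Tendsto.const_mul _ ?_)) _)
    refine Filter.Tendsto.inv_tendsto_atTop ?_
    refine Filter.tendsto_atTop_add_const_right _ _ ?_
    exact Filter.Tendsto.const_mul_atTop (by norm_num) tendsto_natCast_atTop_atTop
  have := ge_of_tendsto' hlim hb
  simpa using this

theorem sg_fin {m k : ℕ} (p : ℝ) (hp1 : 1 ≤ p) (hp2 : p ≤ 2)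
    (g : (Fin k → ℤ) →+ (Fin m → ℝ)) (t : Fin m → ℝ) (hs : Summable fun z => sg p (g z)) :
    ∑' z, sg p (g z + t) ≤ ∑' z, sg p (g z) := by
  refine Real.tsum_le_of_sum_le (fun z => (sg_pos p _).le) fun S => ?_
  have : ∃ M : ℕ, S ⊆ bx k M := by
    refine ⟨∑ z ∈ S, ∑ i, (z i).natAbs, fun z hz => ?_⟩
    rw [mem_bx]
    intro i
    have h1 : (z i).natAbs ≤ ∑ i, (z i).natAbs :=
      Finset.single_le_sum (f := fun i => (z i).natAbs) (fun _ _ => Nat.zero_le _) (Finset.mem_univ i)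
    have h2 : ∑ i, (z i).natAbs ≤ ∑ z ∈ S, ∑ i, (z i).natAbs :=
      Finset.single_le_sum (f := fun z : Fin k → ℤ => ∑ i, (z i).natAbs)
        (fun _ _ => Nat.zero_le _) hz
    have h3 := h1.trans h2
    generalize ∑ z ∈ S, ∑ i, (z i).natAbs = Q at h3
    omega
  obtain ⟨M, hM⟩ := this
  exact (Finset.sum_le_sum_of_subset_of_nonneg hM fun z _ _ => (sg_pos p _).le).trans
    (sg_box_lim p hp1 hp2 g t hs M)

theorem summable_int_exp (p : ℝ) (hp1 : 1 ≤ p) :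
    Summable fun kk : ℤ => Real.exp (-|(kk : ℝ)| ^ p) := by
  have h : Summable fun kk : ℤ => Real.exp (-|(kk : ℝ)|) := by
    refine Summable.of_nat_of_neg ?_ ?_ <;> simpa using Real.summable_exp_neg_nat
  refine Summable.of_nonneg_of_le (fun _ => (Real.exp_pos _).le) (fun z => ?_) h
  rw [Real.exp_le_exp, neg_le_neg_iff]
  by_cases hz : z = 0
  · subst hz
    simp [Real.zero_rpow (by linarith : p ≠ 0)]
  · have : (1:ℝ) ≤ |(z:ℝ)| := by
      exact_mod_cast Int.one_le_abs hz
    simpa using Real.rpow_le_rpow_of_exponent_le this hp1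

/-- The lattice parametrisation, scaled by r. -/
noncomputable def latHom {m k : ℕ} (r : ℝ) (b : Fin k → (Fin m → ℝ)) :
    (Fin k → ℤ) →+ (Fin m → ℝ) where
  toFun z := r • ∑ i, z i • b i
  map_zero' := by simp
  map_add' x y := by simp [add_smul, Finset.sum_add_distrib]

theorem lat_equiv {m k : ℕ} (b : Fin k → (Fin m → ℝ)) (hb : LinearIndependent ℝ b)
    (L : Set (Fin m → ℝ)) (hL : L = {v | ∃ z : Fin k → ℤ, v = ∑ i, z i • b i}) :
    ∃ e : (Fin k → ℤ) ≃ L, ∀ z, ((e z : L) : Fin m → ℝ) = ∑ i, z i • b i := by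
  subst hL
  refine ⟨Equiv.ofBijective (fun z => ⟨∑ i, z i • b i, z, rfl⟩) ⟨?_, ?_⟩, fun z => rfl⟩
  · intro x y h
    have h' : ∑ i, x i • b i = ∑ i, y i • b i := congrArg Subtype.val h
    have h2 : ∑ i, ((x i : ℝ) - y i) • b i = 0 := by
      simp only [sub_smul, Finset.sum_sub_distrib, Int.cast_smul_eq_zsmul]
      rw [h', sub_self]
    have := Fintype.linearIndependent_iff.mp hb _ h2
    funext i
    have := this i
    exact_mod_cast sub_eq_zero.mp this
  · rintro ⟨v, z, rfl⟩
    exact ⟨z, rfl⟩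

theorem lat_shift {m k : ℕ} (p r : ℝ) (hp1 : 1 ≤ p) (hp2 : p ≤ 2)
    (b : Fin k → (Fin m → ℝ)) (hb : LinearIndependent ℝ b)
    (L : Set (Fin m → ℝ)) (hL : L = {v | ∃ z : Fin k → ℤ, v = ∑ i, z i • b i})
    (t : Fin m → ℝ) (hs : Summable (fun x : L => sg p (r • (x : Fin m → ℝ)))) :
    ∑' x : L, sg p (r • (x : Fin m → ℝ) + t) ≤ ∑' x : L, sg p (r • (x : Fin m → ℝ)) := by
  obtain ⟨e, he⟩ := lat_equiv b hb L hL
  rw [← e.tsum_eq, ← e.tsum_eq (fun x : L => sg p (r • (x : Fin m → ℝ)))]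
  rw [← e.summable_iff] at hs
  simp only [Function.comp_def, he] at hs ⊢
  exact sg_fin p hp1 hp2 (latHom r b) t hs


theorem stmt_19 (m k : ℕ) (p α : ℝ) (hp1 : 1 ≤ p) (hp2 : p ≤ 2) (hα : 0 < α)
    (b : Fin k → (Fin m → ℝ)) (hb : LinearIndependent ℝ b)
    (L : Set (Fin m → ℝ)) (hL : L = {v | ∃ z : Fin k → ℤ, v = ∑ i, z i • b i})
    (t : Fin m → ℝ)
    (hs : Summable (fun x : L => Real.exp (-(∑ i, |(x : Fin m → ℝ) i| ^ p))))
    (hsα : Summable (fun x : L => Real.exp (-(∑ i, |((1 / α) • (x : Fin m → ℝ)) i| ^ p))))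
    (hpair : Summable (fun u : L × ℤ =>
      Real.exp (-((∑ i, |((1 / α) • ((u.1 : Fin m → ℝ) - (u.2 : ℝ) • t)) i| ^ p)
        + |(u.2 : ℝ)| ^ p)))) :
    ((∑' x : L, Real.exp (-(∑ i, |((x : Fin m → ℝ) + t) i| ^ p)))
        ≤ ∑' x : L, Real.exp (-(∑ i, |(x : Fin m → ℝ) i| ^ p))) ∧
    ((∑' u : L × ℤ,
        Real.exp (-((∑ i, |((1 / α) • ((u.1 : Fin m → ℝ) - (u.2 : ℝ) • t)) i| ^ p)
          + |(u.2 : ℝ)| ^ p)))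
      = ∑' kk : ℤ, Real.exp (-|(kk : ℝ)| ^ p) *
          ∑' u : L, Real.exp (-(∑ i, |((1 / α) • ((u : Fin m → ℝ) - (kk : ℝ) • t)) i| ^ p))) ∧
    ((∑' u : L × ℤ,
        Real.exp (-((∑ i, |((1 / α) • ((u.1 : Fin m → ℝ) - (u.2 : ℝ) • t)) i| ^ p)
          + |(u.2 : ℝ)| ^ p)))
      ≤ (∑' kk : ℤ, Real.exp (-|(kk : ℝ)| ^ p)) *
          ∑' u : L, Real.exp (-(∑ i, |((1 / α) • (u : Fin m → ℝ)) i| ^ p))) := by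
  have hlayer : ∀ kk : ℤ,
      ∑' u : L, Real.exp (-(∑ i, |((1 / α) • ((u : Fin m → ℝ) - (kk : ℝ) • t)) i| ^ p)) ≤
      ∑' u : L, Real.exp (-(∑ i, |((1 / α) • (u : Fin m → ℝ)) i| ^ p)) := by
    intro kk
    have h := lat_shift p (1 / α) hp1 hp2 b hb L hL (-((1 / α) • ((kk : ℝ) • t))) hsα
    simp only [← sub_eq_add_neg, ← smul_sub] at h
    exact h
  have hfac : ∀ u : L × ℤ,
      Real.exp (-((∑ i, |((1 / α) • ((u.1 : Fin m → ℝ) - (u.2 : ℝ) • t)) i| ^ p)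
        + |(u.2 : ℝ)| ^ p)) = Real.exp (-|(u.2 : ℝ)| ^ p) *
        Real.exp (-(∑ i, |((1 / α) • ((u.1 : Fin m → ℝ) - (u.2 : ℝ) • t)) i| ^ p)) := by
    intro u
    rw [← Real.exp_add]
    congr 1
    ring
  have hpair' := (Equiv.prodComm ℤ L).summable_iff.mpr hpair
  have heq : (∑' u : L × ℤ,
        Real.exp (-((∑ i, |((1 / α) • ((u.1 : Fin m → ℝ) - (u.2 : ℝ) • t)) i| ^ p)
          + |(u.2 : ℝ)| ^ p)))
      = ∑' kk : ℤ, Real.exp (-|(kk : ℝ)| ^ p) *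
          ∑' u : L, Real.exp (-(∑ i, |((1 / α) • ((u : Fin m → ℝ) - (kk : ℝ) • t)) i| ^ p)) := by
    rw [← (Equiv.prodComm ℤ L).tsum_eq]
    refine hpair'.tsum_prod.trans ?_
    refine tsum_congr fun kk => ?_
    rw [← tsum_mul_left]
    exact tsum_congr fun u => hfac (u, kk)
  refine ⟨?_, heq, ?_⟩
  · have h := lat_shift p 1 hp1 hp2 b hb L hL t (by simp only [one_smul]; exact hs)
    simp only [one_smul] at h
    exact h
  · rw [heq, ← tsum_mul_right]
    have hsum := (summable_int_exp p hp1).mul_right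
      (∑' u : L, Real.exp (-(∑ i, |((1 / α) • (u : Fin m → ℝ)) i| ^ p)))
    have hle : ∀ kk : ℤ, Real.exp (-|(kk : ℝ)| ^ p) *
          ∑' u : L, Real.exp (-(∑ i, |((1 / α) • ((u : Fin m → ℝ) - (kk : ℝ) • t)) i| ^ p)) ≤
        Real.exp (-|(kk : ℝ)| ^ p) *
          ∑' u : L, Real.exp (-(∑ i, |((1 / α) • (u : Fin m → ℝ)) i| ^ p)) :=
      fun kk => mul_le_mul_of_nonneg_left (hlayer kk) (Real.exp_pos _).le
    refine Summable.tsum_le_tsum hle (Summable.of_nonneg_of_le (fun kk => ?_) hle hsum) hsum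
    exact mul_nonneg (Real.exp_pos _).le (tsum_nonneg fun _ => (Real.exp_pos _).le)
end
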